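/- Let p_n = f(n) / C(2n−2, n−1) be the probability that a pair of compositions chosen uniformly at random from all ordered pairs of compositions of n into the same number of parts is irreducible. Then p_n ∼ 8/n as n → ∞; that is, n · p_n → 8. -/

import Mathlib

/-- `b : Fin k → ℕ` is a composition of `n` into `k` (positive) parts. -/
def IsComposition (n k : ℕ) (b : Fin k → ℕ) : Prop :=
  (∀ i, 0 < b i) ∧ ∑ i, b i = n

/-- An ordered pair of compositions of `n` into `k` parts is irreducible if
their partial sums disagree at every index `j = 1, …, k-1`. -/
def IsIrreduciblePair (n k : ℕ) (b b' : Fin k → ℕ) : Prop :=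
  IsComposition n k b ∧ IsComposition n k b' ∧
    ∀ j : ℕ, 1 ≤ j → j < k →
      ∑ i ∈ Finset.univ.filter (fun i : Fin k => (i : ℕ) < j), b i ≠
        ∑ i ∈ Finset.univ.filter (fun i : Fin k => (i : ℕ) < j), b' i

/-- `f n` is the number of irreducible ordered pairs of compositions of `n`
into the same number of parts (summed over all numbers of parts `k`). -/
noncomputable def numIrreduciblePairs (n : ℕ) : ℕ :=
  Nat.card {p : Σ k : ℕ, (Fin k → ℕ) × (Fin k → ℕ) //
    IsIrreduciblePair n p.1 p.2.1 p.2.2}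

open Finset

/-- The finset of compositions of `n` into `k` parts. -/
def compositionFinset (n k : ℕ) : Finset (Fin k → ℕ) :=
  (piAntidiag univ n).filter fun b => ∀ i, 0 < b i

theorem mem_compositionFinset {n k : ℕ} {b : Fin k → ℕ} :
    b ∈ compositionFinset n k ↔ IsComposition n k b := by
  simp [compositionFinset, IsComposition, and_comm]

theorem IsComposition.le {n k : ℕ} {b : Fin k → ℕ} (h : IsComposition n k b) : k ≤ n := by
  rw [← h.2]
  simpa using Finset.card_nsmul_le_sum univ b 1 fun i _ => h.1 i

theorem card_piAntidiag_univ_fin (k m : ℕ) :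
    #(piAntidiag (univ : Finset (Fin k)) m) = (k + m - 1).choose m := by
  rw [← map_sym_eq_piAntidiag, card_map, sym_univ, card_univ, Sym.card_sym_eq_choose,
    Fintype.card_fin]

theorem card_compositionFinset (n k : ℕ) :
    #(compositionFinset (n + 1) (k + 1)) = n.choose k := by
  rcases le_or_gt k n with hkn | hkn
  · have : #(piAntidiag (univ : Finset (Fin (k + 1))) (n - k)) = n.choose k := by
      rw [card_piAntidiag_univ_fin, show k + 1 + (n - k) - 1 = n by omega, Nat.choose_symm hkn]
    rw [← this]
    symm
    refine card_bij (fun b _ i => b i + 1) ?_ ?_ ?_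
    · intro b hb
      rw [mem_compositionFinset]
      refine ⟨fun i => Nat.succ_pos _, ?_⟩
      have := (mem_piAntidiag.1 hb).1
      rw [sum_add_distrib, this]
      simp
      omega
    · intro a _ b _ h
      funext i
      simpa using congrFun h i
    · intro b hb
      rw [mem_compositionFinset] at hb
      refine ⟨fun i => b i - 1, ?_, ?_⟩
      · rw [mem_piAntidiag]
        refine ⟨?_, by simp⟩
        have h : ∑ i, (b i - 1 + 1) = n + 1 := by
          rw [← hb.2]
          exact sum_congr rfl fun i _ => Nat.sub_add_cancel (hb.1 i)
        rw [sum_add_distrib] at h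
        simp at h
        omega
      · funext i
        exact Nat.sub_add_cancel (hb.1 i)
  · rw [Nat.choose_eq_zero_of_lt hkn, card_eq_zero, eq_empty_iff_forall_notMem]
    intro b hb
    have := (mem_compositionFinset.1 hb).le
    omega

/-- The finset of pairs of compositions of `n` with the same number of parts. -/
def compositionPairFinset (n : ℕ) : Finset (Σ k : ℕ, (Fin k → ℕ) × (Fin k → ℕ)) :=
  (range (n + 1)).sigma fun k => compositionFinset n k ×ˢ compositionFinset n k

theorem mem_compositionPairFinset {n : ℕ} {p : Σ k : ℕ, (Fin k → ℕ) × (Fin k → ℕ)} :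
    p ∈ compositionPairFinset n ↔ IsComposition n p.1 p.2.1 ∧ IsComposition n p.1 p.2.2 := by
  simp only [compositionPairFinset, mem_sigma, mem_range, mem_product, mem_compositionFinset]
  exact ⟨fun h => h.2, fun h => ⟨Nat.lt_succ_of_le h.1.le, h⟩⟩

theorem card_compositionPairFinset_succ (n : ℕ) :
    #(compositionPairFinset (n + 1)) = n.centralBinom := by
  have h0 : compositionFinset (n + 1) 0 = ∅ := by
    rw [eq_empty_iff_forall_notMem]
    intro b hb
    simpa using (mem_compositionFinset.1 hb).2
  rw [compositionPairFinset, card_sigma, sum_range_succ', h0]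
  simp only [card_product, card_compositionFinset, card_empty, mul_zero, add_zero]
  rw [Nat.centralBinom, ← Nat.sum_range_choose_sq]
  exact sum_congr rfl fun i _ => (sq _).symm

theorem card_compositionPairFinset_zero : #(compositionPairFinset 0) = 1 := by
  decide

/-- The list of columns of a pair of tuples. -/
def columns (p : Σ k : ℕ, (Fin k → ℕ) × (Fin k → ℕ)) : List (ℕ × ℕ) :=
  List.ofFn fun i => (p.2.1 i, p.2.2 i)

theorem columns_injective : Function.Injective columns := by
  rintro ⟨k, b, c⟩ ⟨k', b', c'⟩ h
  rw [columns, columns, List.ofFn_inj'] at h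
  obtain rfl : k = k' := congrArg Sigma.fst h
  have h' := fun i => congrFun (eq_of_heq (Sigma.mk.inj h).2) i
  simp only [Prod.mk.injEq] at h'
  obtain rfl : b = b' := funext fun i => (h' i).1
  obtain rfl : c = c' := funext fun i => (h' i).2
  rfl

theorem exists_columns_eq (l : List (ℕ × ℕ)) : ∃ p, columns p = l :=
  ⟨⟨l.length, fun i => (l.get i).1, fun i => (l.get i).2⟩, by simp [columns]⟩

/-- The lists of pairs of positive integers both of whose coordinates sum to `n`. -/
def pairLists (n : ℕ) : Finset (List (ℕ × ℕ)) := (compositionPairFinset n).image columns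

theorem mem_pairLists {n : ℕ} {l : List (ℕ × ℕ)} :
    l ∈ pairLists n ↔ (∀ x ∈ l, 0 < x.1 ∧ 0 < x.2) ∧
      (l.map Prod.fst).sum = n ∧ (l.map Prod.snd).sum = n := by
  obtain ⟨p, rfl⟩ := exists_columns_eq l
  rw [pairLists, columns_injective.mem_finset_image, mem_compositionPairFinset]
  simp only [IsComposition, columns, List.forall_mem_ofFn_iff, List.map_ofFn, List.sum_ofFn,
    Function.comp_apply, forall_and]
  tauto

/-- The lists in `pairLists n` whose proper nonempty prefixes have distinct coordinate sums. -/
def irreduciblePairLists (n : ℕ) : Finset (List (ℕ × ℕ)) :=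
  {l ∈ pairLists n | l ≠ [] ∧ ∀ j < l.length, 1 ≤ j →
    ((l.take j).map Prod.fst).sum ≠ ((l.take j).map Prod.snd).sum}

theorem numIrreduciblePairs_eq {n : ℕ} (hn : n ≠ 0) :
    numIrreduciblePairs n = #(irreduciblePairLists n) := by
  classical
  have h : irreduciblePairLists n = ((compositionPairFinset n).filter fun p =>
      IsIrreduciblePair n p.1 p.2.1 p.2.2).image columns := by
    ext l
    obtain ⟨p, rfl⟩ := exists_columns_eq l
    rw [columns_injective.mem_finset_image, irreduciblePairLists, mem_filter, mem_filter,
      pairLists, columns_injective.mem_finset_image]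
    refine and_congr_right fun hp => ?_
    have hp' := mem_compositionPairFinset.1 hp
    have h0 : columns p ≠ [] := by
      intro h
      have : columns p ∈ pairLists n := mem_image_of_mem _ hp
      rw [h, mem_pairLists] at this
      simp at this
      omega
    simp only [IsIrreduciblePair, hp', true_and, h0, ne_eq, not_false_eq_true]
    simp only [columns, List.map_ofFn, List.sum_take_ofFn, List.length_ofFn, List.map_take]
    constructor
    · intro h j h1 h2
      exact h j h2 h1
    · intro h j h1 h2
      exact h j h2 h1
  rw [h, card_image_of_injective _ columns_injective]
  refine Nat.subtype_card _ fun p => ?_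
  rw [mem_filter, mem_compositionPairFinset]
  exact ⟨fun h => h.2, fun h => ⟨⟨h.1, h.2.1⟩, h⟩⟩

theorem card_pairLists (n : ℕ) : #(pairLists n) = #(compositionPairFinset n) :=
  card_image_of_injective _ columns_injective

theorem card_pairLists_decomposition {n : ℕ} (hn : n ≠ 0) :
    #(pairLists n) =
      ∑ m ∈ antidiagonal n, #(irreduciblePairLists m.1) * #(pairLists m.2) := by
  simp_rw [← card_product, ← card_sigma]
  symm
  refine card_bij (fun x _ => x.2.1 ++ x.2.2) ?_ ?_ ?_
  · rintro ⟨⟨a, b⟩, l, l'⟩ h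
    simp only [mem_sigma, HasAntidiagonal.mem_antidiagonal, mem_product,
      irreduciblePairLists, mem_filter, mem_pairLists] at h ⊢
    obtain ⟨rfl, ⟨⟨h1, h2, h3⟩, -⟩, h4, h5, h6⟩ := h
    simp only [List.map_append, List.sum_append, List.mem_append]
    refine ⟨?_, by omega, by omega⟩
    rintro x (hx | hx)
    exacts [h1 x hx, h4 x hx]
  · have aux : ∀ (a b c d : ℕ) (l l' m m' : List (ℕ × ℕ)),
        l ∈ irreduciblePairLists a → m ∈ irreduciblePairLists c →
        l ++ l' = m ++ m' → m.length ≤ l.length := by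
      intro a b c d l l' m m' hl hm h
      by_contra! hlt
      simp only [irreduciblePairLists, mem_filter, mem_pairLists] at hl hm
      refine hm.2.2 l.length hlt (List.length_pos_iff.2 hl.2.1) ?_
      have : m.take l.length = l := by
        have := congrArg (List.take l.length) h
        rw [List.take_left, List.take_append_of_le_length hlt.le] at this
        exact this.symm
      rw [this, hl.1.2.1, hl.1.2.2]
    rintro ⟨⟨a, b⟩, l, l'⟩ h ⟨⟨c, d⟩, m, m'⟩ h' heq
    simp only [mem_sigma, HasAntidiagonal.mem_antidiagonal, mem_product] at h h'
    have hlen := le_antisymm (aux c d a b m m' l l' h'.2.1 h.2.1 heq.symm)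
      (aux a b c d l l' m m' h.2.1 h'.2.1 heq)
    obtain ⟨rfl, rfl⟩ := List.append_inj heq hlen
    simp only [irreduciblePairLists, mem_filter, mem_pairLists] at h h'
    obtain rfl : a = c := h.2.1.1.2.1.symm.trans h'.2.1.1.2.1
    obtain rfl : b = d := by omega
    rfl
  · intro l hl
    rw [mem_pairLists] at hl
    have hl0 : l ≠ [] := by
      rintro rfl
      simp at hl
      omega
    have hex : ∃ j, 1 ≤ j ∧
        ((l.take j).map Prod.fst).sum = ((l.take j).map Prod.snd).sum :=
      ⟨l.length, List.length_pos_iff.2 hl0, by rw [List.take_length, hl.2.1, hl.2.2]⟩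
    obtain ⟨hj1, hj⟩ := Nat.find_spec hex
    have hmin := fun i => Nat.find_min (m := i) hex
    have hjl : Nat.find hex ≤ l.length :=
      Nat.find_min' hex ⟨List.length_pos_iff.2 hl0, by rw [List.take_length, hl.2.1, hl.2.2]⟩
    generalize Nat.find hex = j at hj1 hj hmin hjl
    have hs1 := hl.2.1
    have hs2 := hl.2.2
    rw [← List.take_append_drop j l, List.map_append, List.sum_append] at hs1 hs2
    refine ⟨⟨⟨((l.take j).map Prod.fst).sum, ((l.drop j).map Prod.fst).sum⟩, l.take j, l.drop j⟩,
      ?_, List.take_append_drop j l⟩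
    simp only [mem_sigma, HasAntidiagonal.mem_antidiagonal, mem_product,
      irreduciblePairLists, mem_filter, mem_pairLists]
    refine ⟨hs1, ⟨⟨fun x hx => hl.1 x (List.mem_of_mem_take hx), trivial, hj.symm⟩, ?_, ?_⟩,
      fun x hx => hl.1 x (List.mem_of_mem_drop hx), trivial, by omega⟩
    · intro h
      rw [List.take_eq_nil_iff] at h
      rcases h with h | h
      · omega
      · exact hl0 h
    · intro i hi h1 he
      rw [List.length_take, min_eq_left hjl] at hi
      rw [List.take_take, min_eq_left hi.le] at he
      exact hmin i hi ⟨h1, he⟩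

theorem irreduciblePairLists_zero : irreduciblePairLists 0 = ∅ := by
  rw [eq_empty_iff_forall_notMem]
  intro l hl
  simp only [irreduciblePairLists, mem_filter, mem_pairLists] at hl
  obtain ⟨x, hx⟩ := List.exists_mem_of_ne_nil l hl.2.1
  have := List.single_le_sum (l := l.map Prod.fst) (by simp) _ (List.mem_map_of_mem hx)
  have := (hl.1.1 x hx).1
  omega

open PowerSeries Filter Topology

theorem Nat.fib_le_five_thirds_pow (k : ℕ) : (Nat.fib k : ℝ) ≤ (5 / 3) ^ k := by
  have h : (Nat.fib k : ℝ) ≤ (5 / 3) ^ k ∧ (Nat.fib (k + 1) : ℝ) ≤ (5 / 3) ^ (k + 1) := by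
    induction k with
    | zero => norm_num
    | succ k ih =>
      refine ⟨ih.2, ?_⟩
      rw [Nat.fib_add_two]
      push_cast
      have : (0 : ℝ) < (5 / 3) ^ k := by positivity
      have h2 := ih.2
      rw [pow_succ] at h2
      rw [pow_succ, pow_succ]
      linarith [ih.1]
  exact h.1

theorem sum_range_add_two_mul_fib_div (N : ℕ) :
    ∑ k ∈ Finset.range N, ((k : ℝ) + 2) * Nat.fib k / 2 ^ (k + 1) =
      7 - ((N + 5) * Nat.fib N + (N + 7) * Nat.fib (N + 1)) / 2 ^ N := by
  induction N with
  | zero => norm_num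
  | succ N ih =>
    rw [Finset.sum_range_succ, ih, Nat.fib_add_two]
    push_cast
    field_simp
    ring

theorem hasSum_add_two_mul_fib_div :
    HasSum (fun k : ℕ => ((k : ℝ) + 2) * Nat.fib k / 2 ^ (k + 1)) 7 := by
  rw [hasSum_iff_tendsto_nat_of_nonneg (fun k => by positivity)]
  simp_rw [sum_range_add_two_mul_fib_div]
  have h1 : Tendsto (fun N : ℕ => (N : ℝ) * (5 / 6) ^ N) atTop (𝓝 0) :=
    tendsto_self_mul_const_pow_of_lt_one (by norm_num) (by norm_num)
  have h2 : Tendsto (fun N : ℕ => ((5 / 6 : ℝ)) ^ N) atTop (𝓝 0) :=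
    tendsto_pow_atTop_nhds_zero_of_lt_one (by norm_num) (by norm_num)
  have h3 : Tendsto (fun N : ℕ => (8 / 3 : ℝ) * (N * (5 / 6) ^ N) + 50 / 3 * (5 / 6) ^ N)
      atTop (𝓝 0) := by
    simpa using (h1.const_mul (8 / 3)).add (h2.const_mul (50 / 3))
  have h4 : Tendsto (fun N : ℕ => (((N : ℝ) + 5) * Nat.fib N + (N + 7) * Nat.fib (N + 1)) / 2 ^ N)
      atTop (𝓝 0) := by
    refine squeeze_zero (fun N => by positivity) (fun N => ?_) h3
    have e : ((5 / 6 : ℝ)) ^ N = (5 / 3) ^ N / 2 ^ N := by rw [← div_pow]; norm_num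
    have ha := Nat.fib_le_five_thirds_pow N
    have hb := Nat.fib_le_five_thirds_pow (N + 1)
    calc _ ≤ (((N : ℝ) + 5) * (5 / 3) ^ N + (N + 7) * (5 / 3) ^ (N + 1)) / 2 ^ N := by gcongr
      _ = _ := by rw [e, pow_succ]; ring
  simpa using h4.const_sub 7

/-- The coefficients of the derivative of `(X - X ^ 2) / (1 - X - X ^ 2)`. -/
def fibDerivCoeff : ℕ → ℝ
  | 0 => 1
  | k + 1 => (k + 2) * Nat.fib k

theorem hasSum_fibDerivCoeff_div : HasSum (fun k => fibDerivCoeff k / 2 ^ k) 8 := by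
  rw [← hasSum_nat_add_iff' 1]
  simpa [fibDerivCoeff, show (8 : ℝ) - 1 = 7 by norm_num] using hasSum_add_two_mul_fib_div

theorem fibDerivCoeff_nonneg (k : ℕ) : 0 ≤ fibDerivCoeff k := by
  cases k <;> simp only [fibDerivCoeff] <;> positivity

theorem choose_two_mul_sub_succ {m : ℕ} (hm : m ≠ 0) (j : ℕ) :
    ((2 * m - (j + 1)).choose m : ℝ) * (2 * m - j) = (2 * m - j).choose m * (m - j) := by
  rcases le_or_gt j m with h | h
  · have := Nat.choose_mul_succ_eq (2 * m - (j + 1)) m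
    rw [show 2 * m - (j + 1) + 1 = 2 * m - j by omega, show 2 * m - j - m = m - j by omega] at this
    have h' : ((2 * m - (j + 1)).choose m * (2 * m - j : ℕ) : ℝ) =
      (2 * m - j).choose m * (m - j : ℕ) := by exact_mod_cast this
    rw [Nat.cast_sub (by omega), Nat.cast_sub h] at h'
    exact_mod_cast h'
  · rw [Nat.choose_eq_zero_of_lt (by omega), Nat.choose_eq_zero_of_lt (by omega)]
    simp

theorem two_mul_choose_two_mul_sub_succ_le {m : ℕ} (hm : m ≠ 0) (j : ℕ) :
    2 * ((2 * m - (j + 1)).choose m : ℝ) ≤ (2 * m - j).choose m := by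
  rcases le_or_gt j m with h | h
  · have := choose_two_mul_sub_succ hm j
    have h1 : (j : ℝ) ≤ m := by exact_mod_cast h
    have h2 : (0 : ℝ) < m := by positivity
    have h3 : (0 : ℝ) ≤ (2 * m - j).choose m := by positivity
    have h4 : (0 : ℝ) ≤ j := by positivity
    refine le_of_mul_le_mul_right ?_ (show (0 : ℝ) < 2 * m - j by linarith)
    nlinarith
  · rw [Nat.choose_eq_zero_of_lt (by omega), Nat.choose_eq_zero_of_lt (by omega)]
    simp

theorem choose_two_mul_sub_div_le {m : ℕ} (hm : m ≠ 0) (j : ℕ) :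
    ((2 * m - j).choose m : ℝ) / m.centralBinom ≤ 1 / 2 ^ j := by
  have hpos : (0 : ℝ) < m.centralBinom := by exact_mod_cast m.centralBinom_pos
  induction j with
  | zero => simp [Nat.centralBinom, div_self_le_one]
  | succ j ih =>
    have := div_le_div_of_nonneg_right (two_mul_choose_two_mul_sub_succ_le hm j) hpos.le
    have e : (1 : ℝ) / 2 ^ (j + 1) = 1 / 2 ^ j / 2 := by rw [pow_succ]; field_simp
    rw [mul_div_assoc] at this
    rw [e]
    linarith

theorem tendsto_choose_two_mul_sub_div (j : ℕ) :
    Tendsto (fun m : ℕ => ((2 * m - j).choose m : ℝ) / m.centralBinom) atTop (𝓝 (1 / 2 ^ j)) := by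
  induction j with
  | zero =>
    refine tendsto_const_nhds.congr fun m => ?_
    have hpos : (0 : ℝ) < m.centralBinom := by exact_mod_cast m.centralBinom_pos
    rw [Nat.sub_zero, ← Nat.centralBinom, div_self hpos.ne', pow_zero, div_one]
  | succ j ih =>
    have hj : Tendsto (fun m : ℕ => (j : ℝ) / m) atTop (𝓝 0) :=
      tendsto_const_div_atTop_nhds_zero_nat _
    have hr : Tendsto (fun m : ℕ => (1 - (j : ℝ) / m) / (2 - (j : ℝ) / m)) atTop (𝓝 (1 / 2)) := by
      have h := (hj.const_sub 1).div (hj.const_sub 2) (by norm_num)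
      rwa [sub_zero, sub_zero] at h
    have := ih.mul hr
    rw [show (1 : ℝ) / 2 ^ j * (1 / 2) = 1 / 2 ^ (j + 1) by rw [pow_succ]; field_simp] at this
    refine this.congr' ?_
    filter_upwards [eventually_gt_atTop j] with m hm
    have h := choose_two_mul_sub_succ (m := m) (by omega) j
    have h1 : (j : ℝ) < m := by exact_mod_cast hm
    have h2 : (0 : ℝ) ≤ j := by positivity
    have h3 : (2 * (m : ℝ) - j) ≠ 0 := by linarith
    have h4 : (m : ℝ) ≠ 0 := by linarith
    rw [show (1 - (j : ℝ) / m) / (2 - (j : ℝ) / m) = (m - j) / (2 * m - j) by field_simp]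
    rw [eq_div_of_mul_eq h3 h]
    ring

theorem tendsto_tsum_fibDerivCoeff_mul :
    Tendsto (fun m : ℕ => ∑' j, fibDerivCoeff j *
      (((2 * m - j).choose m : ℝ) / m.centralBinom)) atTop (𝓝 8) := by
  rw [← hasSum_fibDerivCoeff_div.tsum_eq]
  refine tendsto_tsum_of_dominated_convergence hasSum_fibDerivCoeff_div.summable (fun j => ?_) ?_
  · simpa [div_eq_mul_inv] using (tendsto_choose_two_mul_sub_div j).const_mul (fibDerivCoeff j)
  · filter_upwards [eventually_ne_atTop 0] with m hm j
    rw [Real.norm_of_nonneg (mul_nonneg (fibDerivCoeff_nonneg j) (by positivity)),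
      div_eq_mul_one_div (fibDerivCoeff j)]
    exact mul_le_mul_of_nonneg_left (choose_two_mul_sub_div_le hm j) (fibDerivCoeff_nonneg j)

/-- The power series `X * C(X)`, where `C` is the Catalan generating function. -/
noncomputable def shiftedCatalanSeries : ℝ⟦X⟧ :=
  X * PowerSeries.map (Nat.castRingHom ℝ) catalanSeries

local notation "U" => shiftedCatalanSeries

theorem shiftedCatalanSeries_sub_sq : U - U ^ 2 = X := by
  have h := congrArg (PowerSeries.map (Nat.castRingHom ℝ)) catalanSeries_sq_mul_X_add_one
  simp only [map_add, map_mul, map_pow, PowerSeries.map_X, map_one] at h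
  rw [shiftedCatalanSeries]
  linear_combination (-X) * h

theorem derivative_shiftedCatalanSeries_mul : d⁄dX ℝ U * (1 - 2 * U) = 1 := by
  have h := congrArg (d⁄dX ℝ) shiftedCatalanSeries_sub_sq
  rw [map_sub, Derivation.leibniz_pow, derivative_X] at h
  simp only [smul_eq_mul, nsmul_eq_mul] at h
  norm_num at h
  linear_combination h

theorem constantCoeff_shiftedCatalanSeries : constantCoeff U = 0 := by
  simp [shiftedCatalanSeries]

theorem coeff_derivative_shiftedCatalanSeries (m : ℕ) :
    coeff m (d⁄dX ℝ U) = m.centralBinom := by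
  rw [coeff_derivative, shiftedCatalanSeries, coeff_succ_X_mul, coeff_map, catalanSeries_coeff,
    ← succ_mul_catalan_eq_centralBinom]
  push_cast
  simp [mul_comm]

theorem coeff_shiftedCatalanSeries_pow_mul_of_lt {j m : ℕ} (h : m < j) (f : ℝ⟦X⟧) :
    coeff m (U ^ j * f) = 0 := by
  rw [shiftedCatalanSeries, mul_pow, mul_assoc, coeff_X_pow_mul', if_neg (by omega)]

theorem coeff_shiftedCatalanSeries_pow_mul_derivative (j m : ℕ) (h : j ≤ m) :
    coeff m (U ^ j * d⁄dX ℝ U) = ((2 * m - j).choose m : ℝ) := by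
  induction j using Nat.twoStepInduction generalizing m with
  | zero => simp [coeff_derivative_shiftedCatalanSeries, Nat.centralBinom]
  | one =>
    obtain ⟨m, rfl⟩ := Nat.exists_eq_succ_of_ne_zero (show m ≠ 0 by omega)
    have e : C (2 : ℝ) * (U ^ 1 * d⁄dX ℝ U) = d⁄dX ℝ U - 1 := by
      rw [show C (2 : ℝ) = 2 from map_ofNat _ 2]
      linear_combination -derivative_shiftedCatalanSeries_mul
    have := congrArg (coeff (m + 1)) e
    rw [coeff_C_mul, map_sub, coeff_derivative_shiftedCatalanSeries, coeff_one,
      if_neg (Nat.succ_ne_zero m), Nat.centralBinom_eq_two_mul_choose,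
      show 2 * (m + 1) = 2 * m + 1 + 1 by ring, Nat.choose_succ_succ',
      Nat.choose_symm_half] at this
    rw [show 2 * (m + 1) - 1 = 2 * m + 1 by omega]
    push_cast at this
    rw [← Nat.choose_symm_half] at this
    linarith
  | more j ih0 ih1 =>
    obtain ⟨m, rfl⟩ := Nat.exists_eq_succ_of_ne_zero (show m ≠ 0 by omega)
    have e : U ^ (j + 2) * d⁄dX ℝ U = U ^ (j + 1) * d⁄dX ℝ U - X * (U ^ j * d⁄dX ℝ U) := by
      linear_combination (-U ^ j * d⁄dX ℝ U) * shiftedCatalanSeries_sub_sq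
    rw [e, map_sub, Nat.succ_eq_add_one, coeff_succ_X_mul, ih1 _ (by omega), ih0 _ (by omega),
      show 2 * (m + 1) - (j + 1) = 2 * m - j + 1 by omega,
      show 2 * (m + 1) - (j + 2) = 2 * m - j by omega, Nat.choose_succ_succ']
    push_cast
    ring

/-- The power series `(X - X ^ 2) / (1 - X - X ^ 2)`. -/
noncomputable def fibSeries : ℝ⟦X⟧ := X + X ^ 2 * PowerSeries.mk fun k => (Nat.fib k : ℝ)

theorem fibSeries_mul : fibSeries * (1 - X - X ^ 2) = X - X ^ 2 := by
  have h : (PowerSeries.mk fun k => (Nat.fib k : ℝ)) * (1 - X - X ^ 2) = X := by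
    rw [mul_sub, mul_sub, mul_one]
    ext n
    rcases n with _ | _ | n
    · simp
    · simp [coeff_succ_mul_X, coeff_mul_X_pow', coeff_X]
    · rw [map_sub, map_sub, coeff_succ_mul_X, add_assoc, coeff_mul_X_pow, coeff_mk, coeff_mk,
        coeff_mk, coeff_X, if_neg (by omega), Nat.fib_add_two]
      push_cast
      ring
  rw [fibSeries]
  linear_combination X ^ 2 * h

theorem succ_mul_coeff_fibSeries (k : ℕ) :
    ((k : ℝ) + 1) * coeff (k + 1) fibSeries = fibDerivCoeff k := by
  rcases k with _ | k
  · simp [fibSeries, fibDerivCoeff, coeff_X_pow_mul']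
  · simp [fibSeries, fibDerivCoeff, coeff_X_pow_mul', coeff_X]
    left
    ring

theorem hasSubst_shiftedCatalanSeries : HasSubst U :=
  HasSubst.of_constantCoeff_zero' constantCoeff_shiftedCatalanSeries

theorem subst_fibSeries_mul :
    fibSeries.subst U * (X + (1 - 2 * U)) = X := by
  have h := congrArg (PowerSeries.substAlgHom hasSubst_shiftedCatalanSeries) fibSeries_mul
  simp only [map_mul, map_sub, map_pow, map_one, substAlgHom_X, coe_substAlgHom] at h
  linear_combination h + (1 - fibSeries.subst U) * shiftedCatalanSeries_sub_sq

theorem coeff_subst_fibSeries {m : ℕ} (hm : m ≠ 0) :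
    ((m : ℝ) + 1) * coeff (m + 1) (fibSeries.subst U : ℝ⟦X⟧) =
      ∑' j, fibDerivCoeff j * ((2 * m - j).choose m : ℝ) := by
  have hpow : ∀ d : ℕ, ((m : ℝ) + 1) * coeff (m + 1) (U ^ (d + 1)) =
      (d + 1) * coeff m (U ^ d * d⁄dX ℝ U) := by
    intro d
    rw [mul_comm, ← coeff_derivative, Derivation.leibniz_pow, add_tsub_cancel_right, smul_eq_mul,
      ← Nat.cast_smul_eq_nsmul ℝ, coeff_smul]
    push_cast
    rfl
  rw [coeff_subst' hasSubst_shiftedCatalanSeries,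
    finsum_eq_sum_of_support_subset (s := Finset.range (m + 2)),
    tsum_eq_sum (s := Finset.range (m + 1)), Finset.sum_range_succ']
  · have h0 : coeff 0 fibSeries = 0 := by simp [fibSeries]
    rw [h0, zero_smul, add_zero, Finset.mul_sum]
    refine Finset.sum_congr rfl fun j hj => ?_
    rw [smul_eq_mul, mul_left_comm, hpow, ← succ_mul_coeff_fibSeries,
      coeff_shiftedCatalanSeries_pow_mul_derivative j m (by simpa [Nat.lt_succ_iff] using hj)]
    ring
  · intro j hj
    rw [Finset.mem_range] at hj
    rw [Nat.choose_eq_zero_of_lt (by omega), Nat.cast_zero, mul_zero]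
  · intro d hd
    by_contra h
    simp only [Finset.coe_range, Set.mem_Iio, not_lt] at h
    refine hd ?_
    have := coeff_shiftedCatalanSeries_pow_mul_of_lt (show m + 1 < d by omega) 1
    rw [mul_one] at this
    simp only [this, smul_zero]

theorem mk_card_pairLists :
    (PowerSeries.mk fun n => (#(pairLists n) : ℝ)) = 1 + X * d⁄dX ℝ U := by
  ext n
  rcases n with _ | n
  · simp [card_pairLists, card_compositionPairFinset_zero]
  · rw [coeff_mk, map_add, coeff_succ_X_mul, coeff_derivative_shiftedCatalanSeries, card_pairLists,
      card_compositionPairFinset_succ, coeff_one, if_neg (Nat.succ_ne_zero n), zero_add]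

theorem mk_card_irreduciblePairLists :
    (PowerSeries.mk fun n => (#(irreduciblePairLists n) : ℝ)) = fibSeries.subst U := by
  set F := PowerSeries.mk fun n => (#(irreduciblePairLists n) : ℝ) with hF
  have h1 : F * (1 + X * d⁄dX ℝ U) = X * d⁄dX ℝ U := by
    suffices F * (1 + X * d⁄dX ℝ U) = 1 + X * d⁄dX ℝ U - 1 by rwa [add_sub_cancel_left] at this
    rw [← mk_card_pairLists]
    ext n
    rw [coeff_mul, map_sub, coeff_one]
    simp only [hF, coeff_mk]
    split_ifs with hn
    · subst hn
      simp [irreduciblePairLists_zero, card_pairLists, card_compositionPairFinset_zero]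
    · rw [card_pairLists_decomposition hn]
      push_cast
      ring
  have h2 : F * (X + (1 - 2 * U)) = X := by
    linear_combination (1 - 2 * U) * h1 + X * (1 - F) * derivative_shiftedCatalanSeries_mul
  have h3 : (X + (1 - 2 * U)) ≠ 0 := by
    intro h
    have := congrArg constantCoeff h
    simp [constantCoeff_shiftedCatalanSeries] at this
  exact mul_right_cancel₀ h3 (h2.trans subst_fibSeries_mul.symm)

/-- **The probability that a random pair of compositions of `n` (with the same
number of parts) is irreducible is asymptotic to `8/n`**: with
`p_n = f(n) / C(2n-2, n-1)`, one has `n · p_n → 8`. -/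
theorem irreduciblePairs_probability_asymptotics :
    Filter.Tendsto
      (fun n : ℕ => (n : ℝ) * (numIrreduciblePairs n : ℝ) /
        (Nat.choose (2 * n - 2) (n - 1) : ℝ))
      Filter.atTop (nhds 8) := by
  rw [← tendsto_add_atTop_iff_nat 1]
  refine tendsto_tsum_fibDerivCoeff_mul.congr' ?_
  filter_upwards [eventually_ne_atTop 0] with m hm
  rw [numIrreduciblePairs_eq (Nat.succ_ne_zero m),
    ← coeff_mk (m + 1) fun n => (#(irreduciblePairLists n) : ℝ), mk_card_irreduciblePairLists,
    Nat.cast_succ, coeff_subst_fibSeries hm, ← tsum_div_const,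
    show 2 * (m + 1) - 2 = 2 * m by omega, Nat.add_sub_cancel, ← Nat.centralBinom]
  simp_rw [mul_div_assoc]
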